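/- For every positive integer m, t(1,1,6,24; 4m+1) = 2·t(2,2,3,3; m), and t(1,1,6,24; 4m) = t(1,1,3,3; m) = 2^{α+4}·σ(m₁), where m+1 = 2^α · 3^β · m₁ with m₁ a positive integer coprime to 6. -/

import Mathlib

/-- `N a b c d n` : number of integer quadruples `(x,y,z,w)` with
`n = a*x^2 + b*y^2 + c*z^2 + d*w^2`. -/
noncomputable def N (a b c d : ℕ) (n : ℕ) : ℕ :=
  Set.ncard {P : ℤ × ℤ × ℤ × ℤ |
    (n : ℤ) = a * P.1 ^ 2 + b * P.2.1 ^ 2 + c * P.2.2.1 ^ 2 + d * P.2.2.2 ^ 2}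

/-- `t a b c d n` : number of integer quadruples `(x,y,z,w)` with
`n = a*x(x-1)/2 + b*y(y-1)/2 + c*z(z-1)/2 + d*w(w-1)/2`. -/
noncomputable def t (a b c d : ℕ) (n : ℕ) : ℕ :=
  Set.ncard {P : ℤ × ℤ × ℤ × ℤ |
    (n : ℤ) = a * (P.1 * (P.1 - 1) / 2) + b * (P.2.1 * (P.2.1 - 1) / 2)
      + c * (P.2.2.1 * (P.2.2.1 - 1) / 2) + d * (P.2.2.2 * (P.2.2.2 - 1) / 2)}


def chi3 (n : ℕ) : ℤ := if n % 3 = 1 then 1 else if n % 3 = 2 then -1 else 0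

lemma chi3_mul (a b : ℕ) : chi3 (a * b) = chi3 a * chi3 b := by
  have ha : a % 3 < 3 := Nat.mod_lt _ (by norm_num)
  have hb : b % 3 < 3 := Nat.mod_lt _ (by norm_num)
  unfold chi3
  rw [Nat.mul_mod]
  interval_cases a % 3 <;> interval_cases b % 3 <;> simp

def SS (n : ℕ) : ℤ := ∑ d ∈ n.divisors, chi3 d

lemma SS_rec (p n : ℕ) (hp : p.Prime) (hn : 0 < n) :
    SS (p * n) = (1 + chi3 p) * SS n - chi3 p * (if p ∣ n then SS (n / p) else 0) := by
  have hpp := hp.pos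
  have hunion : (p * n).divisors = n.divisors ∪ n.divisors.image (fun e => p * e) := by
    ext d
    simp only [Nat.mem_divisors, Finset.mem_union, Finset.mem_image]
    constructor
    · rintro ⟨h1, h2⟩
      by_cases hd : p ∣ d
      · obtain ⟨e, rfl⟩ := hd
        exact Or.inr ⟨e, ⟨(Nat.mul_dvd_mul_iff_left hpp).1 h1, hn.ne'⟩, rfl⟩
      · left
        exact ⟨(Nat.Coprime.symm ((Nat.Prime.coprime_iff_not_dvd hp).2 hd)).dvd_of_dvd_mul_left h1, hn.ne'⟩
    · rintro (⟨h1, h2⟩ | ⟨e, ⟨h1, h2⟩, rfl⟩)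
      · exact ⟨h1.mul_left p, by positivity⟩
      · exact ⟨Nat.mul_dvd_mul_left p h1, by positivity⟩
  have himg : ∀ s : Finset ℕ, ∑ d ∈ s.image (fun e => p * e), chi3 d = chi3 p * ∑ d ∈ s, chi3 d := by
    intro s
    rw [Finset.sum_image (fun a _ b _ h => Nat.eq_of_mul_eq_mul_left hpp h), Finset.mul_sum]
    exact Finset.sum_congr rfl (fun d _ => chi3_mul p d)
  have hint : ∑ d ∈ n.divisors ∩ n.divisors.image (fun e => p * e), chi3 d
      = chi3 p * (if p ∣ n then SS (n / p) else 0) := by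
    split_ifs with h
    · obtain ⟨k, rfl⟩ := h
      have hk : 0 < k := Nat.pos_of_mul_pos_left hn
      rw [Nat.mul_div_cancel_left k hpp]
      unfold SS
      rw [← himg]
      congr 1
      ext d
      simp only [Nat.mem_divisors, Finset.mem_inter, Finset.mem_image]
      constructor
      · rintro ⟨⟨h1, _⟩, ⟨e, ⟨h2, _⟩, rfl⟩⟩
        exact ⟨e, ⟨(Nat.mul_dvd_mul_iff_left hpp).1 h1, hk.ne'⟩, rfl⟩
      · rintro ⟨e, ⟨h2, _⟩, rfl⟩
        exact ⟨⟨Nat.mul_dvd_mul_left p h2, hn.ne'⟩, e, ⟨h2.mul_left p, hn.ne'⟩, rfl⟩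
    · rw [mul_zero]
      apply Finset.sum_eq_zero
      intro d hd
      simp only [Nat.mem_divisors, Finset.mem_inter, Finset.mem_image] at hd
      obtain ⟨⟨h1, _⟩, ⟨e, ⟨h2, _⟩, rfl⟩⟩ := hd
      exact absurd (dvd_of_mul_right_dvd h1) h
  have := Finset.sum_union_inter (s₁ := n.divisors) (s₂ := n.divisors.image (fun e => p * e)) (f := chi3)
  rw [← hunion, hint, himg] at this
  unfold SS at *
  linarith

noncomputable def GG (n : ℕ) : Finset (ℤ × ℤ) :=
  (Finset.Icc (-(2 * n : ℤ)) (2 * n) ×ˢ Finset.Icc (-(2 * n : ℤ)) (2 * n)).filter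
    (fun P => P.1 ^ 2 + P.1 * P.2 + P.2 ^ 2 = n)

lemma mem_GG (n : ℕ) (P : ℤ × ℤ) : P ∈ GG n ↔ P.1 ^ 2 + P.1 * P.2 + P.2 ^ 2 = n := by
  obtain ⟨x, y⟩ := P
  simp only [GG, Finset.mem_filter, Finset.mem_product, Finset.mem_Icc, and_iff_right_iff_imp]
  intro h
  have key : ∀ x y : ℤ, x ^ 2 + x * y + y ^ 2 = n → -(2 * n : ℤ) ≤ x ∧ x ≤ 2 * n := by
    intro x y h
    have h3 : 3 * x ^ 2 ≤ 4 * n := by nlinarith [sq_nonneg (x + 2 * y)]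
    have h4 : x ≤ x ^ 2 := Int.le_self_sq x
    have h5 : -x ≤ x ^ 2 := by simpa using Int.le_self_sq (-x)
    constructor <;> nlinarith [sq_nonneg x]
  exact ⟨key x y h, key y x (by linarith)⟩

lemma exists_form (p : ℕ) (hp : p.Prime) (h1 : p % 3 = 1) :
    ∃ u v : ℤ, u ^ 2 + u * v + v ^ 2 = p := by
  have : Fact p.Prime := ⟨hp⟩
  obtain ⟨z, hz⟩ : ∃ z : ZMod p, z ^ 2 + z + 1 = 0 := by
    have : Fact (Nat.Prime 3) := ⟨by norm_num⟩
    obtain ⟨g, hg⟩ := exists_prime_orderOf_dvd_card (G := (ZMod p)ˣ) 3 (by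
      rw [ZMod.card_units_eq_totient, Nat.totient_prime hp]; have := hp.two_le; omega)
    refine ⟨(g : ZMod p), ?_⟩
    have h3 : (g : ZMod p) ^ 3 = 1 := by
      rw [← Units.val_pow_eq_pow_val, ← hg, pow_orderOf_eq_one]; rfl
    have hne : (g : ZMod p) - 1 ≠ 0 := by
      intro h
      have : g = 1 := Units.ext (by simpa using sub_eq_zero.1 h)
      rw [this, orderOf_one] at hg
      norm_num at hg
    apply mul_left_cancel₀ hne
    linear_combination h3
  set r := Nat.sqrt p with hr
  have hr1 : r * r ≤ p := Nat.sqrt_le p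
  have hr2 : p < (r + 1) * (r + 1) := Nat.lt_succ_sqrt p
  have hr3 : r * r < p := by
    rcases hr1.lt_or_eq with h | h
    · exact h
    · exfalso
      exact hp.prime.irreducible.not_isSquare ⟨r, h.symm⟩
  obtain ⟨a, ha, b, hb, hab, hf⟩ := Finset.exists_ne_map_eq_of_card_lt_of_maps_to
    (s := Finset.range (r + 1) ×ˢ Finset.range (r + 1)) (t := (Finset.univ : Finset (ZMod p)))
    (by simp [ZMod.card]; exact hr2) (f := fun P => (P.1 : ZMod p) - z * P.2) (by simp [Set.MapsTo])
  obtain ⟨a1, a2⟩ := a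
  obtain ⟨b1, b2⟩ := b
  simp only [Finset.mem_product, Finset.mem_range] at ha hb
  simp only at hf
  set X : ℤ := a1 - b1 with hX
  set Y : ℤ := a2 - b2 with hY
  have hd : (p : ℤ) ∣ X ^ 2 + X * Y + Y ^ 2 := by
    rw [← ZMod.intCast_zmod_eq_zero_iff_dvd]
    have e : (X : ZMod p) = z * (Y : ZMod p) := by
      rw [hX, hY]; push_cast; linear_combination hf
    push_cast
    rw [e]
    linear_combination (Y : ZMod p) ^ 2 * hz
  have hXr : X ^ 2 ≤ (r : ℤ) ^ 2 := by apply sq_le_sq'; all_goals omega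
  have hYr : Y ^ 2 ≤ (r : ℤ) ^ 2 := by apply sq_le_sq'; all_goals omega
  have hr4 : (r : ℤ) ^ 2 < p := by have : ((r * r : ℕ) : ℤ) < p := by exact_mod_cast hr3
                                   push_cast at this; nlinarith
  have hlt : X ^ 2 + X * Y + Y ^ 2 < 3 * p := by nlinarith [sq_nonneg (X - Y)]
  have hpos : 0 < X ^ 2 + X * Y + Y ^ 2 := by
    by_contra hcon
    have hY0 : Y = 0 := by
      have : Y ^ 2 ≤ 0 := by nlinarith [sq_nonneg (2 * X + Y)]
      exact pow_eq_zero_iff (two_ne_zero) |>.1 (le_antisymm this (sq_nonneg _))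
    have hX0 : X = 0 := by
      have : X ^ 2 ≤ 0 := by nlinarith [sq_nonneg (2 * Y + X)]
      exact pow_eq_zero_iff (two_ne_zero) |>.1 (le_antisymm this (sq_nonneg _))
    apply hab
    ext <;> simp <;> omega
  obtain ⟨k, hk⟩ := hd
  have hpz : (0 : ℤ) < p := by exact_mod_cast hp.pos
  have k1 : 0 < k := by
    rw [hk] at hpos; exact pos_of_mul_pos_right hpos hpz.le
  have k2 : k < 3 := by nlinarith
  have : k = 1 ∨ k = 2 := by omega
  rcases this with rfl | rfl
  · exact ⟨X, Y, by linarith⟩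
  · exfalso
    have hp2 : p % 2 = 1 := by
      rcases hp.eq_two_or_odd with h | h
      · subst h; norm_num at h1
      · exact h
    obtain ⟨c, hc | hc⟩ := Int.even_or_odd' X <;> obtain ⟨d, hd | hd⟩ := Int.even_or_odd' Y <;>
      rw [hc, hd] at hk <;> ring_nf at hk <;> omega

lemma GG_one : (GG 1).card = 6 := by
  have : GG 1 = {(1, 0), (-1, 0), (0, 1), (0, -1), (1, -1), (-1, 1)} := by
    ext ⟨x, y⟩
    rw [mem_GG]
    simp only [Finset.mem_insert, Finset.mem_singleton, Prod.mk.injEq]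
    constructor
    · intro h
      push_cast at h
      have hx1 : x ≤ 1 := by nlinarith [sq_nonneg (x + 2 * y)]
      have hx2 : -1 ≤ x := by nlinarith [sq_nonneg (x + 2 * y)]
      have hy1 : y ≤ 1 := by nlinarith [sq_nonneg (y + 2 * x)]
      have hy2 : -1 ≤ y := by nlinarith [sq_nonneg (y + 2 * x)]
      interval_cases x <;> interval_cases y <;> simp_all
    · rintro (⟨rfl, rfl⟩ | ⟨rfl, rfl⟩ | ⟨rfl, rfl⟩ | ⟨rfl, rfl⟩ | ⟨rfl, rfl⟩ | ⟨rfl, rfl⟩) <;> norm_num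
  rw [this]
  decide

lemma inert_dvd (p : ℕ) (hp : p.Prime) (h2 : p % 3 = 2) (x y : ℤ)
    (h : (p : ℤ) ∣ x ^ 2 + x * y + y ^ 2) : (p : ℤ) ∣ x ∧ (p : ℤ) ∣ y := by
  have : Fact p.Prime := ⟨hp⟩
  rw [← ZMod.intCast_zmod_eq_zero_iff_dvd] at h ⊢
  rw [← ZMod.intCast_zmod_eq_zero_iff_dvd]
  push_cast at h
  generalize (x : ZMod p) = a at *
  generalize (y : ZMod p) = b at *
  have hc : ∀ a : ZMod p, a ^ (3 * (2 * (p / 3) + 1)) = a := by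
    intro a
    have h1 : 3 * (2 * (p / 3) + 1) = p + (p - 1) := by omega
    rw [h1, pow_add, ZMod.pow_card, ← pow_succ', Nat.sub_add_cancel hp.one_le, ZMod.pow_card]
  have hab : a = b := by
    have h3 : a ^ 3 = b ^ 3 := by linear_combination (a - b) * h
    rw [← hc a, ← hc b, pow_mul, pow_mul, h3]
  subst hab
  have h3 : (3 : ZMod p) ≠ 0 := by
    intro h0
    have : ((3 : ℕ) : ZMod p) = 0 := by exact_mod_cast h0
    rw [ZMod.natCast_eq_zero_iff] at this
    have := (Nat.prime_dvd_prime_iff_eq hp (by norm_num)).1 this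
    subst this
    norm_num at h2
  have : 3 * (a * a) = 0 := by linear_combination h
  have : a = 0 := by simpa [h3] using this
  exact ⟨this, this⟩

/-- scaled copies -/
lemma card_GG_scale (p n : ℕ) (hp : p.Prime) :
    ((GG (p * n)).filter (fun P => (p : ℤ) ∣ P.1 ∧ (p : ℤ) ∣ P.2)).card
      = if p ∣ n then (GG (n / p)).card else 0 := by
  have hpz : (p : ℤ) ≠ 0 := by exact_mod_cast hp.ne_zero
  split_ifs with h
  · obtain ⟨k, rfl⟩ := h
    rw [Nat.mul_div_cancel_left k hp.pos]
    symm
    apply Finset.card_bij (fun P _ => ((p : ℤ) * P.1, (p : ℤ) * P.2))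
    · rintro ⟨x, y⟩ hP
      simp only [mem_GG, Finset.mem_filter] at hP ⊢
      refine ⟨?_, dvd_mul_right _ _, dvd_mul_right _ _⟩
      push_cast
      linear_combination (p : ℤ) ^ 2 * hP
    · rintro ⟨x, y⟩ _ ⟨x', y'⟩ _ h
      simpa [hp.ne_zero] using h
    · rintro ⟨x, y⟩ hP
      simp only [mem_GG, Finset.mem_filter] at hP
      obtain ⟨h1, ⟨a, rfl⟩, ⟨b, rfl⟩⟩ := hP
      refine ⟨(a, b), ?_, rfl⟩
      rw [mem_GG]
      apply mul_left_cancel₀ (pow_ne_zero 2 hpz)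
      push_cast at h1
      linear_combination h1
  · rw [Finset.card_eq_zero, Finset.filter_eq_empty_iff]
    rintro ⟨x, y⟩ hP ⟨⟨a, ha⟩, ⟨b, hb⟩⟩
    simp only [mem_GG] at hP ha hb
    subst ha hb
    apply h
    have : (p : ℤ) ∣ n := by
      refine ⟨a ^ 2 + a * b + b ^ 2, ?_⟩
      apply mul_left_cancel₀ hpz
      push_cast at hP
      linear_combination -hP
    exact_mod_cast this

lemma GG_rec (p n : ℕ) (hp : p.Prime) :
    ((GG (p * n)).card : ℤ) = (1 + chi3 p) * (GG n).card
      - chi3 p * (if p ∣ n then ((GG (n / p)).card : ℤ) else 0) := by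
  have hpz : (p : ℤ) ≠ 0 := by exact_mod_cast hp.ne_zero
  have hpp : Prime (p : ℤ) := Nat.prime_iff_prime_int.1 hp
  have hsc := card_GG_scale p n hp
  have hsc' : (if p ∣ n then ((GG (n / p)).card : ℤ) else 0) =
     ((GG (p * n)).filter (fun P => (p : ℤ) ∣ P.1 ∧ (p : ℤ) ∣ P.2)).card := by
    rw [hsc]; split_ifs <;> simp
  rw [hsc']
  have h3 : p % 3 < 3 := Nat.mod_lt _ (by norm_num)
  obtain h | h | h : p % 3 = 0 ∨ p % 3 = 1 ∨ p % 3 = 2 := by omega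
  · have hp3 : p = 3 := by
      have : 3 ∣ p := Nat.dvd_of_mod_eq_zero h
      exact ((Nat.prime_dvd_prime_iff_eq (by norm_num) hp).1 this).symm
    subst hp3
    simp only [chi3]
    norm_num
    symm
    apply Finset.card_bij (fun P _ => (P.1 - P.2, P.1 + 2 * P.2))
    · rintro ⟨x, y⟩ hP
      simp only [mem_GG] at hP ⊢
      push_cast
      linear_combination 3 * hP
    · rintro ⟨x, y⟩ _ ⟨x', y'⟩ _ h
      simp only [Prod.mk.injEq] at h ⊢
      omega
    · rintro ⟨x, y⟩ hP
      simp only [mem_GG] at hP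
      push_cast at hP
      have hd : (3 : ℤ) ∣ y - x := by
        apply Int.prime_three.dvd_of_dvd_pow (n := 2)
        exact ⟨n - x * y, by linear_combination hP⟩
      obtain ⟨b, hb⟩ := hd
      obtain rfl : y = x + 3 * b := by linarith
      refine ⟨(x + b, b), ?_, ?_⟩
      · rw [mem_GG]
        simp only
        linarith
      · simp only [Prod.mk.injEq]; constructor <;> ring
  · have hchi : chi3 p = 1 := by simp [chi3, h]
    rw [hchi]
    obtain ⟨u, v, huv⟩ := exists_form p hp h
    have hp2 : ¬ (p : ℤ) ∣ 2 := by
      intro h0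
      have : p ∣ 2 := by exact_mod_cast h0
      rw [(Nat.prime_dvd_prime_iff_eq hp (by norm_num)).1 this] at h
      norm_num at h
    have hp3 : ¬ (p : ℤ) ∣ 3 := by
      intro h0
      have : p ∣ 3 := by exact_mod_cast h0
      rw [(Nat.prime_dvd_prime_iff_eq hp (by norm_num)).1 this] at h
      norm_num at h
    have huv' : ¬ (p : ℤ) ∣ 2 * u + v := by
      intro h0
      have h1 : (p : ℤ) ∣ 3 * (v * v) := by
        obtain ⟨k, hk⟩ := h0
        exact ⟨4 - k * (2 * u + v), by linear_combination 4 * huv + (-(2*u+v)) * hk⟩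
      have hv : (p : ℤ) ∣ v := by
        rcases hpp.dvd_or_dvd h1 with h | h
        · exact absurd h hp3
        · rcases hpp.dvd_or_dvd h with h | h <;> exact h
      have hu : (p : ℤ) ∣ u := by
        have : (p : ℤ) ∣ 2 * u := by simpa using dvd_sub h0 hv
        exact (hpp.dvd_or_dvd this).resolve_left hp2
      obtain ⟨a, rfl⟩ := hu
      obtain ⟨b, rfl⟩ := hv
      have : (p : ℤ) * (a ^ 2 + a * b + b ^ 2) = 1 := by
        apply mul_left_cancel₀ hpz
        linear_combination huv
      exact hpp.not_isUnit (IsUnit.of_mul_eq_one _ this)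
    have c1 : ((GG (p * n)).filter (fun P => (p : ℤ) ∣ P.2 * u - P.1 * v)).card = (GG n).card := by
      symm
      apply Finset.card_bij (fun P _ => (P.1 * u - P.2 * v, P.1 * v + P.2 * u + P.2 * v))
      · rintro ⟨x, y⟩ hP
        simp only [mem_GG, Finset.mem_filter] at hP ⊢
        push_cast
        refine ⟨?_, y, ?_⟩
        · rw [← huv, ← hP]; ring
        · rw [← huv]; ring
      · rintro ⟨x, y⟩ _ ⟨x', y'⟩ _ h
        simp only [Prod.mk.injEq] at h ⊢
        obtain ⟨h1, h2⟩ := h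
        constructor <;> apply mul_left_cancel₀ hpz
        · rw [← huv]; linear_combination (u + v) * h1 + v * h2
        · rw [← huv]; linear_combination (-v) * h1 + u * h2
      · rintro ⟨x, y⟩ hP
        simp only [mem_GG, Finset.mem_filter] at hP
        push_cast at hP
        obtain ⟨h1, b, hb⟩ := hP
        have ha : (p : ℤ) ∣ x * u + x * v + y * v := by
          apply hpp.dvd_of_dvd_pow (n := 2)
          refine ⟨p * n - b * (x * u + x * v + y * v) - b * (y * u - x * v), ?_⟩
          linear_combination (u^2+u*v+v^2) * h1 + p * n * huv - (x * u + x * v + y * v + (y * u - x * v)) * hb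
        obtain ⟨a, ha⟩ := ha
        refine ⟨(a, b), ?_, ?_⟩
        · rw [mem_GG]
          simp only
          apply mul_left_cancel₀ (pow_ne_zero 2 hpz)
          have : (p * a) ^ 2 + (p * a) * (p * b) + (p * b) ^ 2 = (p : ℤ) * (p * n) := by
            rw [← ha, ← hb, ← h1, ← huv]; ring
          linear_combination this
        · simp only [Prod.mk.injEq]
          constructor <;> apply mul_left_cancel₀ hpz
          · have : (p : ℤ) * (a * u - b * v) = (p * a) * u - (p * b) * v := by ring
            rw [this, ← ha, ← hb, ← huv]; ring
          · have : (p : ℤ) * (a * v + b * u + b * v) = (p * a) * v + (p * b) * u + (p * b) * v := by ring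
            rw [this, ← ha, ← hb, ← huv]; ring
    have c2 : ((GG (p * n)).filter (fun P => (p : ℤ) ∣ P.1 * v + P.2 * u + P.2 * v)).card = (GG n).card := by
      symm
      apply Finset.card_bij (fun P _ => (P.1 * u + P.1 * v + P.2 * v, P.2 * u - P.1 * v))
      · rintro ⟨x, y⟩ hP
        simp only [mem_GG, Finset.mem_filter] at hP ⊢
        push_cast
        refine ⟨?_, y, ?_⟩
        · rw [← huv, ← hP]; ring
        · rw [← huv]; ring
      · rintro ⟨x, y⟩ _ ⟨x', y'⟩ _ h
        simp only [Prod.mk.injEq] at h ⊢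
        obtain ⟨h1, h2⟩ := h
        constructor <;> apply mul_left_cancel₀ hpz
        · rw [← huv]; linear_combination u * h1 - v * h2
        · rw [← huv]; linear_combination v * h1 + (u + v) * h2
      · rintro ⟨x, y⟩ hP
        simp only [mem_GG, Finset.mem_filter] at hP
        push_cast at hP
        obtain ⟨h1, b, hb⟩ := hP
        have ha : (p : ℤ) ∣ x * u - y * v := by
          apply hpp.dvd_of_dvd_pow (n := 2)
          refine ⟨p * n - b * (x * u - y * v) - b * (x * v + y * u + y * v), ?_⟩
          linear_combination (u^2+u*v+v^2) * h1 + p * n * huv - (x * u - y * v + (x * v + y * u + y * v)) * hb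
        obtain ⟨a, ha⟩ := ha
        refine ⟨(a, b), ?_, ?_⟩
        · rw [mem_GG]
          simp only
          apply mul_left_cancel₀ (pow_ne_zero 2 hpz)
          have : (p * a) ^ 2 + (p * a) * (p * b) + (p * b) ^ 2 = (p : ℤ) * (p * n) := by
            rw [← ha, ← hb, ← h1, ← huv]; ring
          linear_combination this
        · simp only [Prod.mk.injEq]
          constructor <;> apply mul_left_cancel₀ hpz
          · have : (p : ℤ) * (a * u + a * v + b * v) = (p * a) * u + (p * a) * v + (p * b) * v := by ring
            rw [this, ← ha, ← hb, ← huv]; ring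
          · have : (p : ℤ) * (b * u - a * v) = (p * b) * u - (p * a) * v := by ring
            rw [this, ← ha, ← hb, ← huv]; ring
    have hU : (GG (p * n)).filter (fun P => (p : ℤ) ∣ P.2 * u - P.1 * v) ∪
        (GG (p * n)).filter (fun P => (p : ℤ) ∣ P.1 * v + P.2 * u + P.2 * v) = GG (p * n) := by
      rw [← Finset.filter_or, Finset.filter_eq_self]
      rintro ⟨x, y⟩ hP
      rw [mem_GG] at hP
      push_cast at hP
      simp only at hP ⊢
      apply hpp.dvd_or_dvd
      refine ⟨y ^ 2 - v ^ 2 * n, ?_⟩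
      linear_combination -v^2 * hP + y^2 * huv
    have hI : (GG (p * n)).filter (fun P => (p : ℤ) ∣ P.2 * u - P.1 * v) ∩
        (GG (p * n)).filter (fun P => (p : ℤ) ∣ P.1 * v + P.2 * u + P.2 * v) =
        (GG (p * n)).filter (fun P => (p : ℤ) ∣ P.1 ∧ (p : ℤ) ∣ P.2) := by
      rw [← Finset.filter_and]
      apply Finset.filter_congr
      rintro ⟨x, y⟩ hP
      rw [mem_GG] at hP
      push_cast at hP
      simp only at hP ⊢
      constructor
      · rintro ⟨h1, h2⟩
        have hy : (p : ℤ) ∣ y := by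
          have : (p : ℤ) ∣ y * (2 * u + v) := by
            have := dvd_add h1 h2
            ring_nf at this ⊢
            exact this
          exact (hpp.dvd_or_dvd this).resolve_right huv'
        refine ⟨?_, hy⟩
        obtain ⟨b, rfl⟩ := hy
        apply hpp.dvd_of_dvd_pow (n := 2)
        exact ⟨n - x * b - p * b ^ 2, by linear_combination hP⟩
      · rintro ⟨⟨a, rfl⟩, ⟨b, rfl⟩⟩
        exact ⟨⟨b * u - a * v, by ring⟩, ⟨a * v + b * u + b * v, by ring⟩⟩
    have := Finset.card_union_add_card_inter ((GG (p * n)).filter (fun P => (p : ℤ) ∣ P.2 * u - P.1 * v))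
        ((GG (p * n)).filter (fun P => (p : ℤ) ∣ P.1 * v + P.2 * u + P.2 * v))
    rw [hU, hI, c1, c2] at this
    have h' : ((GG (p * n)).card : ℤ) + ((GG (p * n)).filter (fun P => (p : ℤ) ∣ P.1 ∧ (p : ℤ) ∣ P.2)).card
      = (GG n).card + (GG n).card := by exact_mod_cast this
    linarith
  · have hchi : chi3 p = -1 := by simp [chi3, h]
    rw [hchi]
    have : (GG (p * n)).filter (fun P => (p : ℤ) ∣ P.1 ∧ (p : ℤ) ∣ P.2) = GG (p * n) := by
      rw [Finset.filter_eq_self]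
      rintro ⟨x, y⟩ hP
      rw [mem_GG] at hP
      push_cast at hP
      exact inert_dvd p hp h x y ⟨n, hP⟩
    rw [this]
    ring

lemma GG_eq (n : ℕ) (hn : 0 < n) : ((GG n).card : ℤ) = 6 * SS n := by
  induction n using Nat.strong_induction_on with
  | _ n ih =>
    by_cases h1 : n = 1
    · subst h1
      rw [GG_one]
      simp [SS, chi3]
    · have hp := Nat.minFac_prime h1
      obtain ⟨k, hk⟩ := Nat.minFac_dvd n
      generalize n.minFac = p at *
      subst hk
      have hk0 : 0 < k := Nat.pos_of_mul_pos_left hn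
      have hlt : k < p * k := by nlinarith [hp.two_le]
      rw [GG_rec p k hp, SS_rec p k hp hk0, ih k hlt hk0]
      split_ifs with hd
      · rw [ih (k / p) (lt_of_le_of_lt (Nat.div_le_self _ _) hlt) (Nat.div_pos (Nat.le_of_dvd hk0 hd) hp.pos)]
        ring
      · ring

noncomputable def HH (n : ℕ) : Finset (ℤ × ℤ) :=
  (Finset.Icc (-(4 * n : ℤ)) (4 * n) ×ˢ Finset.Icc (-(4 * n : ℤ)) (4 * n)).filter
    (fun P => P.1 ^ 2 + 3 * P.2 ^ 2 = 4 * n ∧ P.1 % 2 = 1 ∧ P.2 % 2 = 1)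

lemma mem_HH (n : ℕ) (P : ℤ × ℤ) :
    P ∈ HH n ↔ P.1 ^ 2 + 3 * P.2 ^ 2 = 4 * n ∧ P.1 % 2 = 1 ∧ P.2 % 2 = 1 := by
  obtain ⟨x, y⟩ := P
  simp only [HH, Finset.mem_filter, Finset.mem_product, Finset.mem_Icc, and_iff_right_iff_imp]
  rintro ⟨h, -, -⟩
  have h1 : x ≤ x ^ 2 := Int.le_self_sq x
  have h2 : -x ≤ x ^ 2 := by simpa using Int.le_self_sq (-x)
  have h3 : y ≤ y ^ 2 := Int.le_self_sq y
  have h4 : -y ≤ y ^ 2 := by simpa using Int.le_self_sq (-y)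
  refine ⟨⟨?_, ?_⟩, ?_, ?_⟩ <;> nlinarith [sq_nonneg x, sq_nonneg y]

lemma odd_sq_mod8 (x : ℤ) (h : x % 2 = 1) : ∃ k, x ^ 2 = 8 * k + 1 := by
  obtain ⟨a, rfl⟩ : ∃ a, x = 2 * a + 1 := ⟨x / 2, by omega⟩
  obtain ⟨b, hb⟩ := Int.even_mul_succ_self a
  exact ⟨b, by linear_combination 4 * hb⟩

lemma HH_even (n : ℕ) (hn : n % 2 = 0) : HH n = ∅ := by
  rw [Finset.eq_empty_iff_forall_notMem]
  rintro ⟨x, y⟩ hP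
  rw [mem_HH] at hP
  obtain ⟨h, hx, hy⟩ := hP
  obtain ⟨a, ha⟩ := odd_sq_mod8 x hx
  obtain ⟨b, hb⟩ := odd_sq_mod8 y hy
  simp only at h
  omega

lemma HH_odd (n : ℕ) (hn : n % 2 = 1) : ((HH n).card : ℤ) = 4 * SS n := by
  have hG := GG_eq n (by omega)
  have e1 : (HH n).card = ((GG n).filter (fun P => ¬ P.2 % 2 = 0)).card := by
    symm
    apply Finset.card_bij (fun P _ => (2 * P.1 + P.2, P.2))
    · rintro ⟨x, y⟩ hP
      simp only [mem_GG, mem_HH, Finset.mem_filter] at hP ⊢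
      refine ⟨?_, ?_, ?_⟩
      · linear_combination 4 * hP.1
      · omega
      · omega
    · rintro ⟨x, y⟩ _ ⟨x', y'⟩ _ h
      simp only [Prod.mk.injEq] at h ⊢
      omega
    · rintro ⟨x, y⟩ hP
      rw [mem_HH] at hP
      simp only at hP
      obtain ⟨h, hx, hy⟩ := hP
      obtain ⟨a, rfl⟩ : ∃ a, x = 2 * a + y := ⟨(x - y) / 2, by omega⟩
      refine ⟨(a, y), ?_, rfl⟩
      simp only [mem_GG, Finset.mem_filter]
      exact ⟨by linarith, by omega⟩
  have rot : ∀ (q r : ℤ × ℤ → Prop) [DecidablePred q] [DecidablePred r],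
      (∀ x y, q (x, y) ↔ r (y, -x - y)) →
      ((GG n).filter q).card = ((GG n).filter r).card := by
    intro q r _ _ hqr
    apply Finset.card_bij (fun P _ => (P.2, -P.1 - P.2))
    · rintro ⟨x, y⟩ hP
      simp only [mem_GG, Finset.mem_filter] at hP ⊢
      exact ⟨by linarith, (hqr x y).1 hP.2⟩
    · rintro ⟨x, y⟩ _ ⟨x', y'⟩ _ h
      simp only [Prod.mk.injEq] at h ⊢
      omega
    · rintro ⟨x, y⟩ hP
      simp only [mem_GG, Finset.mem_filter] at hP
      refine ⟨(-x - y, x), ?_, ?_⟩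
      · simp only [mem_GG, Finset.mem_filter]
        refine ⟨by linarith, (hqr _ _).2 ?_⟩
        have : -(-x - y) - x = y := by ring
        rw [this]
        exact hP.2
      · simp
  have r1 := rot (fun P => P.2 % 2 = 0) (fun P => P.1 % 2 = 0) (fun x y => Iff.rfl)
  have r2 := rot (fun P => P.1 % 2 = 0) (fun P => (P.1 + P.2) % 2 = 0) (fun x y => by simp only; omega)
  have s1 := Finset.card_filter_add_card_filter_not (s := GG n) (fun P => P.2 % 2 = 0)
  have s2 := Finset.card_filter_add_card_filter_not (s := (GG n).filter (fun P => ¬ P.2 % 2 = 0)) (fun P => P.1 % 2 = 0)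
  rw [Finset.filter_filter, Finset.filter_filter] at s2
  have par : ∀ P ∈ GG n, ¬ (P.1 % 2 = 0 ∧ P.2 % 2 = 0) := by
    rintro ⟨x, y⟩ hP ⟨hx, hy⟩
    rw [mem_GG] at hP
    simp only at hP hx hy
    obtain ⟨a, rfl⟩ : ∃ a, x = 2 * a := ⟨x / 2, by omega⟩
    obtain ⟨b, rfl⟩ : ∃ b, y = 2 * b := ⟨y / 2, by omega⟩
    ring_nf at hP
    omega
  have f1 : (GG n).filter (fun P => ¬ P.2 % 2 = 0 ∧ P.1 % 2 = 0) = (GG n).filter (fun P => P.1 % 2 = 0) := by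
    apply Finset.filter_congr
    intro P hP
    have := par P hP
    omega
  have f2 : (GG n).filter (fun P => ¬ P.2 % 2 = 0 ∧ ¬ P.1 % 2 = 0) = (GG n).filter (fun P => (P.1 + P.2) % 2 = 0) := by
    apply Finset.filter_congr
    intro P hP
    have := par P hP
    omega
  rw [f1, f2] at s2
  rw [e1]
  omega
def OO (a b c d K : ℤ) : Set (ℤ × ℤ × ℤ × ℤ) :=
  {P | a * P.1 ^ 2 + b * P.2.1 ^ 2 + c * P.2.2.1 ^ 2 + d * P.2.2.2 ^ 2 = K ∧
    P.1 % 2 = 1 ∧ P.2.1 % 2 = 1 ∧ P.2.2.1 % 2 = 1 ∧ P.2.2.2 % 2 = 1}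

lemma tri (x : ℤ) : ∃ k, x * (x - 1) / 2 = k ∧ (2 * x - 1) ^ 2 = 8 * k + 1 := by
  obtain ⟨b, hb⟩ := Int.even_mul_pred_self x
  refine ⟨b, by omega, by linear_combination 4 * hb⟩

lemma t_eq (a b c d n : ℕ) : t a b c d n = (OO a b c d (8 * n + a + b + c + d)).ncard := by
  unfold t
  rw [← Set.ncard_image_of_injective (f := fun P : ℤ × ℤ × ℤ × ℤ =>
    (2 * P.1 - 1, 2 * P.2.1 - 1, 2 * P.2.2.1 - 1, 2 * P.2.2.2 - 1))]
  · congr 1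
    ext ⟨X, Y, Z, W⟩
    simp only [Set.mem_image, Set.mem_ofPred_eq, OO, Prod.exists, Prod.mk.injEq]
    constructor
    · rintro ⟨x, y, z, w, h, rfl, rfl, rfl, rfl⟩
      obtain ⟨k1, e1, f1⟩ := tri x
      obtain ⟨k2, e2, f2⟩ := tri y
      obtain ⟨k3, e3, f3⟩ := tri z
      obtain ⟨k4, e4, f4⟩ := tri w
      rw [e1, e2, e3, e4] at h
      refine ⟨?_, by omega, by omega, by omega, by omega⟩
      rw [f1, f2, f3, f4, h]; ring
    · rintro ⟨h, hx, hy, hz, hw⟩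
      obtain ⟨x, rfl⟩ : ∃ x, X = 2 * x - 1 := ⟨(X + 1) / 2, by omega⟩
      obtain ⟨y, rfl⟩ : ∃ x, Y = 2 * x - 1 := ⟨(Y + 1) / 2, by omega⟩
      obtain ⟨z, rfl⟩ : ∃ x, Z = 2 * x - 1 := ⟨(Z + 1) / 2, by omega⟩
      obtain ⟨w, rfl⟩ : ∃ x, W = 2 * x - 1 := ⟨(W + 1) / 2, by omega⟩
      refine ⟨x, y, z, w, ?_, rfl, rfl, rfl, rfl⟩
      obtain ⟨k1, e1, f1⟩ := tri x
      obtain ⟨k2, e2, f2⟩ := tri y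
      obtain ⟨k3, e3, f3⟩ := tri z
      obtain ⟨k4, e4, f4⟩ := tri w
      rw [e1, e2, e3, e4]
      rw [f1, f2, f3, f4] at h
      linarith
  · rintro ⟨x, y, z, w⟩ ⟨x', y', z', w'⟩ h
    simp only [Prod.mk.injEq] at h ⊢
    omega

lemma ncard_double {α : Type*} (S p : Set α) (e : α → α) (he : ∀ x, e (e x) = x)
    (hS : ∀ x ∈ S, e x ∈ S) (hp : ∀ x ∈ S, (e x ∈ p ↔ x ∉ p)) :
    S.ncard = 2 * (S ∩ p).ncard := by
  have hinj : Function.Injective e := fun a b h => by rw [← he a, h, he]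
  have hdiff : e '' (S ∩ p) = S \ p := by
    ext x
    constructor
    · rintro ⟨y, ⟨hy, hyp⟩, rfl⟩
      refine ⟨hS y hy, fun h => (hp y hy).1 h hyp⟩
    · rintro ⟨hx, hxp⟩
      exact ⟨e x, ⟨hS x hx, (hp x hx).2 hxp⟩, he x⟩
  have hc : (S \ p).ncard = (S ∩ p).ncard := by
    rw [← hdiff, Set.ncard_image_of_injective _ hinj]
  by_cases hf : (S ∩ p).Finite
  · have hf2 : (S \ p).Finite := by rw [← hdiff]; exact hf.image e
    have : S = (S ∩ p) ∪ (S \ p) := (Set.inter_union_sdiff S p).symm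
    rw [two_mul]
    conv_lhs => rw [this]
    rw [Set.ncard_union_eq Set.disjoint_sdiff_inter.symm hf hf2, hc]
  · rw [Set.Infinite.ncard hf, Set.Infinite.ncard (fun h => hf (h.subset Set.inter_subset_left))]

def TT (K : ℤ) : Set (ℤ × ℤ × ℤ × ℤ) :=
  {P | P.1 ^ 2 + P.2.1 ^ 2 + 3 * P.2.2.1 ^ 2 + 3 * P.2.2.2 ^ 2 = K ∧
    P.2.2.2 % 2 = 1 ∧ (P.1 + P.2.2.1) % 2 = 1}

lemma OO_A (K : ℤ) : (OO 1 1 6 24 (8 * K)).ncard = 4 * (TT K).ncard := by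
  rw [ncard_double (OO 1 1 6 24 (8 * K)) {P | (P.1 - P.2.1) % 4 = 0} (fun P => (P.1, -P.2.1, P.2.2.1, P.2.2.2))]
  · rw [ncard_double _ {P | (P.1 + P.2.1 - 2 * P.2.2.1) % 8 = 0} (fun P => (P.1, P.2.1, -P.2.2.1, P.2.2.2))]
    · rw [← mul_assoc]
      congr 1
      rw [← Set.ncard_image_of_injective (TT K) (f := fun P : ℤ × ℤ × ℤ × ℤ =>
        (P.1 + 3 * P.2.2.1 + 2 * P.2.1, P.1 + 3 * P.2.2.1 - 2 * P.2.1, P.1 - P.2.2.1, P.2.2.2))]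
      · congr 1
        ext ⟨X, Y, Z, W⟩
        simp only [Set.mem_image, Set.mem_inter_iff, Set.mem_ofPred_eq, OO, TT, Prod.exists, Prod.mk.injEq]
        constructor
        · rintro ⟨⟨⟨h, hx, hy, hz, hw⟩, h1⟩, h2⟩
          obtain ⟨b, hb⟩ : ∃ b, X = Y + 4 * b := ⟨(X - Y) / 4, by omega⟩
          obtain ⟨q, hq⟩ : ∃ q, Y + 2 * b = Z + 4 * q := ⟨(Y + 2 * b - Z) / 4, by omega⟩
          obtain rfl : Y = Z + 4 * q - 2 * b := by omega
          obtain rfl : X = Z + 4 * q + 2 * b := by omega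
          refine ⟨Z + q, b, q, W, ⟨?_, hw, by omega⟩, by ring, by ring, by ring, rfl⟩
          linarith
        · rintro ⟨p, b, q, w, ⟨h, hw, hpq⟩, rfl, rfl, rfl, rfl⟩
          refine ⟨⟨⟨by linarith, by omega, by omega, by omega, hw⟩, by omega⟩, by omega⟩
      · rintro ⟨x, y, z, w⟩ ⟨x', y', z', w'⟩ h
        simp only [Prod.mk.injEq] at h ⊢
        omega
    · intro x; simp
    · rintro ⟨x, y, z, w⟩ ⟨⟨h, hx, hy, hz, hw⟩, h1⟩
      simp only [Set.mem_inter_iff, Set.mem_ofPred_eq, OO] at *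
      refine ⟨⟨by linarith, hx, hy, by omega, hw⟩, h1⟩
    · rintro ⟨x, y, z, w⟩ ⟨⟨h, hx, hy, hz, hw⟩, h1⟩
      simp only [Set.mem_ofPred_eq] at *
      omega
  · intro x; simp
  · rintro ⟨x, y, z, w⟩ ⟨h, hx, hy, hz, hw⟩
    simp only [Set.mem_ofPred_eq, OO] at *
    refine ⟨by linarith, hx, by omega, hz, hw⟩
  · rintro ⟨x, y, z, w⟩ ⟨h, hx, hy, hz, hw⟩
    simp only [Set.mem_ofPred_eq] at *
    omega

lemma sq_mod (x : ℤ) : (x % 2 = 1 ∧ ∃ k, x ^ 2 = 4 * k + 1) ∨ (x % 2 = 0 ∧ ∃ k, x ^ 2 = 4 * k) := by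
  rcases Int.emod_two_eq_zero_or_one x with h | h
  · right
    obtain ⟨a, rfl⟩ : ∃ a, x = 2 * a := ⟨x / 2, by omega⟩
    exact ⟨h, a ^ 2, by ring⟩
  · left
    obtain ⟨a, rfl⟩ : ∃ a, x = 2 * a + 1 := ⟨x / 2, by omega⟩
    exact ⟨h, a ^ 2 + a, by ring⟩

lemma TT_par (K p b q w : ℤ) (h : p ^ 2 + b ^ 2 + 3 * q ^ 2 + 3 * w ^ 2 = K)
    (hw : w % 2 = 1) (hpq : (p + q) % 2 = 1) (hK : K % 4 = 0 ∨ K % 4 = 1) :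
    p % 2 = 1 ∧ q % 2 = 0 ∧ (b - K) % 2 = 0 := by
  rcases sq_mod p with ⟨hp, k1, e1⟩ | ⟨hp, k1, e1⟩ <;>
  rcases sq_mod b with ⟨hb, k2, e2⟩ | ⟨hb, k2, e2⟩ <;>
  rcases sq_mod q with ⟨hq, k3, e3⟩ | ⟨hq, k3, e3⟩ <;>
  rcases sq_mod w with ⟨hw', k4, e4⟩ | ⟨hw', k4, e4⟩ <;>
  rw [e1, e2, e3, e4] at h <;> omega

lemma OO_B (M : ℤ) : (OO 1 1 3 3 (8 * M)).ncard = 4 * (TT (4 * M)).ncard := by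
  rw [ncard_double (OO 1 1 3 3 (8 * M)) {P | (P.1 - P.2.1) % 4 = 0} (fun P => (P.1, -P.2.1, P.2.2.1, P.2.2.2))]
  · rw [ncard_double _ {P | (P.2.2.1 - P.2.2.2) % 4 = 0} (fun P => (P.1, P.2.1, P.2.2.1, -P.2.2.2))]
    · rw [← mul_assoc]
      congr 1
      rw [← Set.ncard_image_of_injective (TT (4 * M)) (f := fun P : ℤ × ℤ × ℤ × ℤ =>
        (P.1 + P.2.1, P.1 - P.2.1, P.2.2.2 + P.2.2.1, P.2.2.2 - P.2.2.1))]
      · congr 1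
        ext ⟨X, Y, Z, W⟩
        simp only [Set.mem_image, Set.mem_inter_iff, Set.mem_ofPred_eq, OO, TT, Prod.exists, Prod.mk.injEq]
        constructor
        · rintro ⟨⟨⟨h, hx, hy, hz, hw⟩, h1⟩, h2⟩
          obtain ⟨b, rfl⟩ : ∃ b, X = Y + 2 * b := ⟨(X - Y) / 2, by omega⟩
          obtain ⟨q, rfl⟩ : ∃ q, Z = W + 2 * q := ⟨(Z - W) / 2, by omega⟩
          refine ⟨Y + b, b, q, W + q, ⟨?_, by omega, by omega⟩, by ring, by ring, by ring, by ring⟩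
          linarith
        · rintro ⟨p, b, q, w, ⟨h, hw, hpq⟩, rfl, rfl, rfl, rfl⟩
          have := TT_par _ p b q w h hw hpq (by omega)
          refine ⟨⟨⟨by linarith, by omega, by omega, by omega, by omega⟩, by omega⟩, by omega⟩
      · rintro ⟨x, y, z, w⟩ ⟨x', y', z', w'⟩ h
        simp only [Prod.mk.injEq] at h ⊢
        omega
    · intro x; simp
    · rintro ⟨x, y, z, w⟩ ⟨⟨h, hx, hy, hz, hw⟩, h1⟩
      simp only [Set.mem_inter_iff, Set.mem_ofPred_eq, OO] at *
      refine ⟨⟨by linarith, hx, hy, by omega, by omega⟩, h1⟩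
    · rintro ⟨x, y, z, w⟩ ⟨⟨h, hx, hy, hz, hw⟩, h1⟩
      simp only [Set.mem_ofPred_eq] at *
      omega
  · intro x; simp
  · rintro ⟨x, y, z, w⟩ ⟨h, hx, hy, hz, hw⟩
    simp only [Set.mem_ofPred_eq, OO] at *
    refine ⟨by linarith, hx, by omega, hz, hw⟩
  · rintro ⟨x, y, z, w⟩ ⟨h, hx, hy, hz, hw⟩
    simp only [Set.mem_ofPred_eq] at *
    omega

lemma OO_C (M : ℤ) : (OO 2 2 3 3 (8 * M + 10)).ncard = 2 * (TT (4 * M + 5)).ncard := by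
  rw [ncard_double _ {P | (P.2.2.1 - P.2.2.2) % 4 = 0} (fun P => (P.1, P.2.1, P.2.2.1, -P.2.2.2))]
  · congr 1
    rw [← Set.ncard_image_of_injective (TT (4 * M + 5)) (f := fun P : ℤ × ℤ × ℤ × ℤ =>
        (P.1, P.2.1, P.2.2.2 + P.2.2.1, P.2.2.2 - P.2.2.1))]
    · congr 1
      ext ⟨X, Y, Z, W⟩
      simp only [Set.mem_image, Set.mem_inter_iff, Set.mem_ofPred_eq, OO, TT, Prod.exists, Prod.mk.injEq]
      constructor
      · rintro ⟨⟨h, hx, hy, hz, hw⟩, h2⟩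
        obtain ⟨q, rfl⟩ : ∃ q, Z = W + 2 * q := ⟨(Z - W) / 2, by omega⟩
        refine ⟨X, Y, q, W + q, ⟨?_, by omega, by omega⟩, by ring, by ring, by ring, by ring⟩
        linarith
      · rintro ⟨p, b, q, w, ⟨h, hw, hpq⟩, rfl, rfl, rfl, rfl⟩
        have := TT_par _ p b q w h hw hpq (by omega)
        refine ⟨⟨by linarith, by omega, by omega, by omega, by omega⟩, by omega⟩
    · rintro ⟨x, y, z, w⟩ ⟨x', y', z', w'⟩ h
      simp only [Prod.mk.injEq] at h ⊢
      omega
  · intro x; simp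
  · rintro ⟨x, y, z, w⟩ ⟨h, hx, hy, hz, hw⟩
    simp only [Set.mem_ofPred_eq, OO] at *
    refine ⟨by linarith, hx, hy, by omega, by omega⟩
  · rintro ⟨x, y, z, w⟩ ⟨h, hx, hy, hz, hw⟩
    simp only [Set.mem_ofPred_eq] at *
    omega

lemma OO_sum (M : ℕ) : (OO 1 1 3 3 (8 * M)).ncard =
    ∑ ab ∈ Finset.HasAntidiagonal.antidiagonal (2 * M), (HH ab.1).card * (HH ab.2).card := by
  have h1 : ∑ ab ∈ Finset.HasAntidiagonal.antidiagonal (2 * M), (HH ab.1).card * (HH ab.2).card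
     = ((Finset.HasAntidiagonal.antidiagonal (2 * M)).sigma (fun ab => HH ab.1 ×ˢ HH ab.2)).card := by
    rw [Finset.card_sigma]
    exact Finset.sum_congr rfl (fun ab _ => (Finset.card_product _ _).symm)
  have h2 : OO 1 1 3 3 (8 * M) = ((((Finset.HasAntidiagonal.antidiagonal (2 * M)).sigma (fun ab => HH ab.1 ×ˢ HH ab.2)).image
      (fun s => (s.2.1.1, s.2.2.1, s.2.1.2, s.2.2.2)) : Finset (ℤ × ℤ × ℤ × ℤ)) : Set (ℤ × ℤ × ℤ × ℤ)) := by
    ext ⟨X, Y, Z, W⟩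
    rw [Finset.mem_coe, Finset.mem_image]
    simp only [OO, Set.mem_ofPred_eq, Finset.mem_sigma, Finset.HasAntidiagonal.mem_antidiagonal, Finset.mem_product, mem_HH, Prod.mk.injEq]
    constructor
    · rintro ⟨h, hx, hy, hz, hw⟩
      obtain ⟨k1, e1⟩ := odd_sq_mod8 X hx
      obtain ⟨k2, e2⟩ := odd_sq_mod8 Y hy
      obtain ⟨k3, e3⟩ := odd_sq_mod8 Z hz
      obtain ⟨k4, e4⟩ := odd_sq_mod8 W hw
      have := sq_nonneg X
      have := sq_nonneg Y
      have := sq_nonneg Z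
      have := sq_nonneg W
      refine ⟨⟨(((X ^ 2 + 3 * Z ^ 2) / 4).toNat, ((Y ^ 2 + 3 * W ^ 2) / 4).toNat), ((X, Z), (Y, W))⟩, ⟨?_, ⟨?_, hx, hz⟩, ⟨?_, hy, hw⟩⟩, rfl, rfl, rfl, rfl⟩
      all_goals simp only
      all_goals omega
    · rintro ⟨⟨⟨a, b⟩, ⟨⟨x, z⟩, ⟨y, w⟩⟩⟩, ⟨h, ⟨h1, hx, hz⟩, ⟨h2, hy, hw⟩⟩, rfl, rfl, rfl, rfl⟩
      simp only at *
      refine ⟨?_, hx, hy, hz, hw⟩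
      have : (a : ℤ) + b = 2 * M := by exact_mod_cast h
      linarith
  rw [h1, h2, Set.ncard_coe_finset, Finset.card_image_of_injOn]
  rintro ⟨⟨a, b⟩, ⟨⟨x, z⟩, ⟨y, w⟩⟩⟩ h ⟨⟨a', b'⟩, ⟨⟨x', z'⟩, ⟨y', w'⟩⟩⟩ h' heq
  rw [Finset.mem_coe] at h h'
  simp only [Finset.mem_sigma, Finset.HasAntidiagonal.mem_antidiagonal, Finset.mem_product, mem_HH, Prod.mk.injEq] at h h' heq
  obtain ⟨rfl, rfl, rfl, rfl⟩ := heq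
  obtain ⟨-, ⟨p1, -, -⟩, p2, -, -⟩ := h
  obtain ⟨-, ⟨q1, -, -⟩, q2, -, -⟩ := h'
  obtain rfl : a = a' := by omega
  obtain rfl : b = b' := by omega
  rfl

/-- quadruples (a,x,b,y) of odd positive integers with a*x+b*y = M -/
def LL (M : ℕ) : Finset (ℕ × ℕ × ℕ × ℕ) :=
  (Finset.range (M + 1) ×ˢ Finset.range (M + 1) ×ˢ Finset.range (M + 1) ×ˢ Finset.range (M + 1)).filter
    (fun P => P.1 * P.2.1 + P.2.2.1 * P.2.2.2 = M ∧ P.1 % 2 = 1 ∧ P.2.1 % 2 = 1 ∧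
      P.2.2.1 % 2 = 1 ∧ P.2.2.2 % 2 = 1)

lemma mem_LL (M a x b y : ℕ) : (a, x, b, y) ∈ LL M ↔
    a * x + b * y = M ∧ a % 2 = 1 ∧ x % 2 = 1 ∧ b % 2 = 1 ∧ y % 2 = 1 := by
  simp only [LL, Finset.mem_filter, Finset.mem_product, Finset.mem_range, and_iff_right_iff_imp]
  rintro ⟨h, ha, hx, hb, hy⟩
  have a0 : 0 < a := by omega
  have b0 : 0 < b := by omega
  have x0 : 0 < x := by omega
  have y0 : 0 < y := by omega
  have := Nat.le_mul_of_pos_right a x0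
  have := Nat.le_mul_of_pos_left x a0
  have := Nat.le_mul_of_pos_right b y0
  have := Nat.le_mul_of_pos_left y b0
  omega

lemma sum_LL (M : ℕ) :
    ((∑ ab ∈ Finset.HasAntidiagonal.antidiagonal (2 * M), (HH ab.1).card * (HH ab.2).card : ℕ) : ℤ)
      = 16 * ∑ P ∈ LL (2 * M), chi3 P.1 * chi3 P.2.2.1 := by
  have hSS : ∀ n, SS n = ∑ d ∈ n.divisorsAntidiagonal, chi3 d.1 := by
    intro n
    exact (Nat.sum_divisorsAntidiagonal (fun d _ => chi3 d)).symm
  have h1 : ((∑ ab ∈ Finset.HasAntidiagonal.antidiagonal (2 * M), (HH ab.1).card * (HH ab.2).card : ℕ) : ℤ)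
    = 16 * ∑ ab ∈ (Finset.HasAntidiagonal.antidiagonal (2 * M)).filter (fun ab => ab.1 % 2 = 1), SS ab.1 * SS ab.2 := by
    push_cast
    rw [Finset.sum_filter, Finset.mul_sum]
    apply Finset.sum_congr rfl
    rintro ⟨a, b⟩ hab
    rw [Finset.HasAntidiagonal.mem_antidiagonal] at hab
    simp only at *
    split_ifs with h
    · rw [HH_odd a h, HH_odd b (by omega)]; ring
    · rw [HH_even a (by omega)]; simp
  rw [h1]
  congr 1
  have h2 : ∑ ab ∈ (Finset.HasAntidiagonal.antidiagonal (2 * M)).filter (fun ab => ab.1 % 2 = 1), SS ab.1 * SS ab.2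
    = ∑ ab ∈ (Finset.HasAntidiagonal.antidiagonal (2 * M)).filter (fun ab => ab.1 % 2 = 1),
      ∑ de ∈ ab.1.divisorsAntidiagonal ×ˢ ab.2.divisorsAntidiagonal, chi3 de.1.1 * chi3 de.2.1 := by
    apply Finset.sum_congr rfl
    intro ab _
    rw [hSS, hSS, Finset.sum_mul_sum, Finset.sum_product]
  rw [h2, Finset.sum_sigma']
  apply Finset.sum_bij (fun s _ => (s.2.1.1, s.2.1.2, s.2.2.1, s.2.2.2))
  · rintro ⟨⟨a, b⟩, ⟨⟨d, x⟩, ⟨e, y⟩⟩⟩ h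
    simp only [Finset.mem_sigma, Finset.mem_filter, Finset.HasAntidiagonal.mem_antidiagonal, Finset.mem_product, Nat.mem_divisorsAntidiagonal] at h
    obtain ⟨⟨h1, h2⟩, ⟨rfl, -⟩, rfl, -⟩ := h
    rw [mem_LL]
    have h3 : (e * y) % 2 = 1 := by omega
    rw [← Nat.odd_iff, Nat.odd_mul, Nat.odd_iff, Nat.odd_iff] at h2 h3
    exact ⟨h1, h2.1, h2.2, h3.1, h3.2⟩
  · rintro ⟨⟨a, b⟩, ⟨⟨d, x⟩, ⟨e, y⟩⟩⟩ h ⟨⟨a', b'⟩, ⟨⟨d', x'⟩, ⟨e', y'⟩⟩⟩ h' heq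
    simp only [Finset.mem_sigma, Finset.mem_filter, Finset.HasAntidiagonal.mem_antidiagonal, Finset.mem_product, Nat.mem_divisorsAntidiagonal, Prod.mk.injEq] at h h' heq
    obtain ⟨rfl, rfl, rfl, rfl⟩ := heq
    obtain ⟨⟨h1, h2⟩, ⟨rfl, -⟩, rfl, -⟩ := h
    obtain ⟨⟨-, -⟩, ⟨rfl, -⟩, rfl, -⟩ := h'
    rfl
  · rintro ⟨d, x, e, y⟩ h
    rw [mem_LL] at h
    obtain ⟨h, hd, hx, he, hy⟩ := h
    refine ⟨⟨(d * x, e * y), ((d, x), (e, y))⟩, ?_, rfl⟩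
    simp only [Finset.mem_sigma, Finset.mem_filter, Finset.HasAntidiagonal.mem_antidiagonal, Finset.mem_product, Nat.mem_divisorsAntidiagonal]
    have h1 : (d * x) % 2 = 1 := by rw [← Nat.odd_iff, Nat.odd_mul, Nat.odd_iff, Nat.odd_iff]; exact ⟨hd, hx⟩
    have h2 : (e * y) % 2 = 1 := by rw [← Nat.odd_iff, Nat.odd_mul, Nat.odd_iff, Nat.odd_iff]; exact ⟨he, hy⟩
    exact ⟨⟨h, h1⟩, ⟨trivial, by omega⟩, trivial, by omega⟩
  · intro s _
    rfl

def FF (k : ℤ) : ℤ := if k % 3 = 0 then 1 else 0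

lemma chi3_FF (a b : ℕ) : chi3 a * chi3 b = FF ((a : ℤ) - b) - FF ((a : ℤ) + b) := by
  obtain ha | ha | ha : a % 3 = 0 ∨ a % 3 = 1 ∨ a % 3 = 2 := by omega
  all_goals obtain hb | hb | hb : b % 3 = 0 ∨ b % 3 = 1 ∨ b % 3 = 2 := by omega
  all_goals
    have h1 : ((a : ℤ) - b) % 3 = ((a % 3 : ℕ) - (b % 3 : ℕ) : ℤ) % 3 := by omega
    have h2 : ((a : ℤ) + b) % 3 = ((a % 3 : ℕ) + (b % 3 : ℕ) : ℤ) % 3 := by omega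
    unfold chi3 FF
    rw [h1, h2, ha, hb]
    norm_num

/-- the key bijection -/
lemma key_bij (M : ℕ) (f : ℤ → ℤ) :
    ∑ P ∈ (LL M).filter (fun P => P.2.2.1 < P.1), f ((P.1 : ℤ) - P.2.2.1)
    = ∑ P ∈ (LL M).filter (fun P => P.2.2.2 < P.2.1), f ((P.1 : ℤ) + P.2.2.1) := by
  apply Finset.sum_nbij'
    (fun P => (P.2.2.1 % (P.1 - P.2.2.1),
      P.2.1 + (P.2.2.1 / (P.1 - P.2.2.1)) * (P.2.1 + P.2.2.2) + (P.2.1 + P.2.2.2),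
      (P.1 - P.2.2.1) - P.2.2.1 % (P.1 - P.2.2.1),
      P.2.1 + (P.2.2.1 / (P.1 - P.2.2.1)) * (P.2.1 + P.2.2.2)))
    (fun P => (P.1 + (P.2.2.2 / (P.2.1 - P.2.2.2)) * (P.1 + P.2.2.1) + (P.1 + P.2.2.1),
      P.2.2.2 % (P.2.1 - P.2.2.2),
      P.1 + (P.2.2.2 / (P.2.1 - P.2.2.2)) * (P.1 + P.2.2.1),
      (P.2.1 - P.2.2.2) - P.2.2.2 % (P.2.1 - P.2.2.2)))
  · rintro ⟨a, x, b, y⟩ h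
    simp only [Finset.mem_filter, mem_LL] at h ⊢
    obtain ⟨⟨h, ha, hx, hb, hy⟩, hlt⟩ := h
    obtain ⟨u, rfl⟩ : ∃ u, a = b + u := ⟨a - b, by omega⟩
    rw [Nat.add_sub_cancel_left]
    have hu : 0 < u := by omega
    have hm := Nat.mod_add_div b u
    have hl := Nat.mod_lt b hu
    generalize b % u = r at *
    generalize b / u = q at *
    have hue : u % 2 = 0 := by omega
    have hr : r % 2 = 1 := by
      have : (u * q) % 2 = 0 := by rw [Nat.mul_mod, hue]; simp
      omega
    have hq : (q * (x + y)) % 2 = 0 := by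
      have : (x + y) % 2 = 0 := by omega
      rw [Nat.mul_mod, this]; simp
    refine ⟨⟨?_, hr, by omega, by omega, by omega⟩, by omega⟩
    obtain ⟨v, rfl⟩ : ∃ v, u = r + v := ⟨u - r, by omega⟩
    rw [Nat.add_sub_cancel_left, ← h, ← hm]
    ring
  · rintro ⟨a, x, b, y⟩ h
    simp only [Finset.mem_filter, mem_LL] at h ⊢
    obtain ⟨⟨h, ha, hx, hb, hy⟩, hlt⟩ := h
    obtain ⟨u, rfl⟩ : ∃ u, x = y + u := ⟨x - y, by omega⟩
    rw [Nat.add_sub_cancel_left]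
    have hu : 0 < u := by omega
    have hm := Nat.mod_add_div y u
    have hl := Nat.mod_lt y hu
    generalize y % u = r at *
    generalize y / u = q at *
    have hue : u % 2 = 0 := by omega
    have hr : r % 2 = 1 := by
      have : (u * q) % 2 = 0 := by rw [Nat.mul_mod, hue]; simp
      omega
    have hq : (q * (a + b)) % 2 = 0 := by
      have : (a + b) % 2 = 0 := by omega
      rw [Nat.mul_mod, this]; simp
    refine ⟨⟨?_, by omega, hr, by omega, by omega⟩, by omega⟩
    obtain ⟨v, rfl⟩ : ∃ v, u = r + v := ⟨u - r, by omega⟩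
    rw [Nat.add_sub_cancel_left, ← h, ← hm]
    ring
  · rintro ⟨a, x, b, y⟩ h
    simp only [Finset.mem_filter, mem_LL] at h ⊢
    obtain ⟨⟨h, ha, hx, hb, hy⟩, hlt⟩ := h
    obtain ⟨u, rfl⟩ : ∃ u, a = b + u := ⟨a - b, by omega⟩
    rw [Nat.add_sub_cancel_left]
    have hu : 0 < u := by omega
    have hm := Nat.mod_add_div b u
    have hl := Nat.mod_lt b hu
    generalize b % u = r at *
    generalize b / u = q at *
    have e1 : x + q * (x + y) + (x + y) - (x + q * (x + y)) = x + y := by omega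
    have e2 : r + (u - r) = u := by omega
    have e3 : (x + q * (x + y)) / (x + y) = q := by
      rw [Nat.add_mul_div_right _ _ (by omega), Nat.div_eq_of_lt (by omega), zero_add]
    have e4 : (x + q * (x + y)) % (x + y) = x := by
      rw [Nat.add_mul_mod_self_right, Nat.mod_eq_of_lt (by omega)]
    have e5 : r + q * u = b := by rw [mul_comm q u]; exact hm
    rw [e1, e2, e3, e4, e5, Nat.add_sub_cancel_left]
  · rintro ⟨a, x, b, y⟩ h
    simp only [Finset.mem_filter, mem_LL] at h ⊢
    obtain ⟨⟨h, ha, hx, hb, hy⟩, hlt⟩ := h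
    obtain ⟨u, rfl⟩ : ∃ u, x = y + u := ⟨x - y, by omega⟩
    rw [Nat.add_sub_cancel_left]
    have hu : 0 < u := by omega
    have hm := Nat.mod_add_div y u
    have hl := Nat.mod_lt y hu
    generalize y % u = r at *
    generalize y / u = q at *
    have e1 : a + q * (a + b) + (a + b) - (a + q * (a + b)) = a + b := by omega
    have e2 : r + (u - r) = u := by omega
    have e3 : (a + q * (a + b)) / (a + b) = q := by
      rw [Nat.add_mul_div_right _ _ (by omega), Nat.div_eq_of_lt (by omega), zero_add]
    have e4 : (a + q * (a + b)) % (a + b) = a := by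
      rw [Nat.add_mul_mod_self_right, Nat.mod_eq_of_lt (by omega)]
    have e5 : r + q * u = y := by rw [mul_comm q u]; exact hm
    rw [e1, e2, e3, e4, e5, Nat.add_sub_cancel_left]
  · rintro ⟨a, x, b, y⟩ h
    simp only [Finset.mem_filter, mem_LL] at h ⊢
    obtain ⟨⟨h, ha, hx, hb, hy⟩, hlt⟩ := h
    congr 1
    have hl := Nat.mod_lt b (show 0 < a - b by omega)
    generalize b % (a - b) = r at *
    omega

lemma sum_tri (s : Finset (ℕ × ℕ × ℕ × ℕ)) (u v : ℕ × ℕ × ℕ × ℕ → ℕ) (f : ℕ × ℕ × ℕ × ℕ → ℤ) :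
    ∑ P ∈ s, f P = ∑ P ∈ s.filter (fun P => u P = v P), f P
      + ∑ P ∈ s.filter (fun P => v P < u P), f P + ∑ P ∈ s.filter (fun P => u P < v P), f P := by
  simp only [Finset.sum_filter]
  rw [← Finset.sum_add_distrib, ← Finset.sum_add_distrib]
  apply Finset.sum_congr rfl
  intro P _
  rcases lt_trichotomy (u P) (v P) with h | h | h
  · simp [h, h.ne, h.le.not_gt]
  · simp [h]
  · simp [h, h.ne', h.le.not_gt]

lemma liouville (M : ℕ) :
    ∑ P ∈ LL M, chi3 P.1 * chi3 P.2.2.1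
      = ∑ P ∈ (LL M).filter (fun P => P.2.1 = P.2.2.2), (1 - FF ((P.1 : ℤ) + P.2.2.1)) := by
  have hFneg : ∀ a b : ℤ, FF (a - b) = FF (b - a) := by
    intro a b
    unfold FF
    congr 1
    simp only [eq_iff_iff]
    omega
  simp only [chi3_FF]
  rw [Finset.sum_sub_distrib]
  rw [sum_tri (LL M) (fun P => P.1) (fun P => P.2.2.1) (fun P => FF ((P.1 : ℤ) - P.2.2.1))]
  rw [sum_tri (LL M) (fun P => P.2.1) (fun P => P.2.2.2) (fun P => FF ((P.1 : ℤ) + P.2.2.1))]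
  have hk := key_bij M FF
  have sw1 : ∑ P ∈ (LL M).filter (fun P => P.1 < P.2.2.1), FF ((P.1 : ℤ) - P.2.2.1)
      = ∑ P ∈ (LL M).filter (fun P => P.2.2.1 < P.1), FF ((P.1 : ℤ) - P.2.2.1) := by
    apply Finset.sum_nbij' (fun P => (P.2.2.1, P.2.2.2, P.1, P.2.1)) (fun P => (P.2.2.1, P.2.2.2, P.1, P.2.1))
    · rintro ⟨a, x, b, y⟩ h
      simp only [Finset.mem_filter, mem_LL] at h ⊢
      exact ⟨⟨by linarith, h.1.2.2.2.1, h.1.2.2.2.2, h.1.2.1, h.1.2.2.1⟩, h.2⟩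
    · rintro ⟨a, x, b, y⟩ h
      simp only [Finset.mem_filter, mem_LL] at h ⊢
      exact ⟨⟨by linarith, h.1.2.2.2.1, h.1.2.2.2.2, h.1.2.1, h.1.2.2.1⟩, h.2⟩
    · intro _ _; rfl
    · intro _ _; rfl
    · intro _ _; exact hFneg _ _
  have sw2 : ∑ P ∈ (LL M).filter (fun P => P.2.1 < P.2.2.2), FF ((P.1 : ℤ) + P.2.2.1)
      = ∑ P ∈ (LL M).filter (fun P => P.2.2.2 < P.2.1), FF ((P.1 : ℤ) + P.2.2.1) := by
    apply Finset.sum_nbij' (fun P => (P.2.2.1, P.2.2.2, P.1, P.2.1)) (fun P => (P.2.2.1, P.2.2.2, P.1, P.2.1))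
    · rintro ⟨a, x, b, y⟩ h
      simp only [Finset.mem_filter, mem_LL] at h ⊢
      exact ⟨⟨by linarith, h.1.2.2.2.1, h.1.2.2.2.2, h.1.2.1, h.1.2.2.1⟩, h.2⟩
    · rintro ⟨a, x, b, y⟩ h
      simp only [Finset.mem_filter, mem_LL] at h ⊢
      exact ⟨⟨by linarith, h.1.2.2.2.1, h.1.2.2.2.2, h.1.2.1, h.1.2.2.1⟩, h.2⟩
    · intro _ _; rfl
    · intro _ _; rfl
    · intro P _; simp only; rw [add_comm]
  have sw3 : ∑ P ∈ (LL M).filter (fun P => P.1 = P.2.2.1), FF ((P.1 : ℤ) - P.2.2.1)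
      = ∑ P ∈ (LL M).filter (fun P => P.2.1 = P.2.2.2), (1 : ℤ) := by
    apply Finset.sum_nbij' (fun P => (P.2.1, P.1, P.2.2.2, P.2.2.1)) (fun P => (P.2.1, P.1, P.2.2.2, P.2.2.1))
    · rintro ⟨a, x, b, y⟩ h
      simp only [Finset.mem_filter, mem_LL] at h ⊢
      exact ⟨⟨by linarith, h.1.2.2.1, h.1.2.1, h.1.2.2.2.2, h.1.2.2.2.1⟩, h.2⟩
    · rintro ⟨a, x, b, y⟩ h
      simp only [Finset.mem_filter, mem_LL] at h ⊢
      exact ⟨⟨by linarith, h.1.2.2.1, h.1.2.1, h.1.2.2.2.2, h.1.2.2.2.1⟩, h.2⟩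
    · intro _ _; rfl
    · intro _ _; rfl
    · rintro ⟨a, x, b, y⟩ h
      simp only [Finset.mem_filter] at h ⊢
      simp [FF, h.2]
  rw [Finset.sum_sub_distrib]
  linarith

lemma diag_sum (M : ℕ) (hM : 0 < M) :
    ∑ P ∈ (LL (2 * M)).filter (fun P => P.2.1 = P.2.2.2), (1 - FF ((P.1 : ℤ) + P.2.2.1))
     = ∑ d ∈ M.divisors.filter (fun d => (M / d) % 2 = 1 ∧ ¬ d % 3 = 0), (d : ℤ) := by
  have h1 : ∑ d ∈ M.divisors.filter (fun d => (M / d) % 2 = 1 ∧ ¬ d % 3 = 0), (d : ℤ)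
    = ∑ d ∈ M.divisors.filter (fun d => (M / d) % 2 = 1), ∑ i ∈ Finset.range d, (if d % 3 = 0 then (0 : ℤ) else 1) := by
    rw [← Finset.filter_filter, Finset.sum_filter]
    apply Finset.sum_congr rfl
    intro d _
    split_ifs <;> simp_all
  rw [h1, Finset.sum_sigma']
  symm
  apply Finset.sum_bij (fun s _ => (2 * s.2 + 1, M / s.1, 2 * s.1 - 2 * s.2 - 1, M / s.1))
  · rintro ⟨d, i⟩ h
    simp only [Finset.mem_sigma, Finset.mem_filter, Nat.mem_divisors, Finset.mem_range, mem_LL, and_true] at h ⊢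
    obtain ⟨⟨⟨hd, h0⟩, ho⟩, hi⟩ := h
    refine ⟨?_, by omega, ho, by omega, ho⟩
    rw [← add_mul]
    have : 2 * i + 1 + (2 * d - 2 * i - 1) = 2 * d := by omega
    rw [this, mul_assoc, Nat.mul_div_cancel' hd]
  · rintro ⟨d, i⟩ h ⟨d', i'⟩ h' heq
    simp only [Finset.mem_sigma, Finset.mem_filter, Nat.mem_divisors, Finset.mem_range, Prod.mk.injEq] at h h' heq
    obtain rfl : i = i' := by omega
    obtain rfl : d = d' := by omega
    rfl
  · rintro ⟨a, x, b, y⟩ h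
    simp only [Finset.mem_filter, mem_LL] at h
    obtain ⟨⟨h, ha, hx, hb, hy⟩, rfl⟩ := h
    obtain ⟨i, rfl⟩ : ∃ i, a = 2 * i + 1 := ⟨a / 2, by omega⟩
    obtain ⟨j, rfl⟩ : ∃ i, b = 2 * i + 1 := ⟨b / 2, by omega⟩
    have hMx : M = (i + j + 1) * x := by linarith
    have hdiv : M / (i + j + 1) = x := by rw [hMx]; exact Nat.mul_div_cancel_left _ (by omega)
    refine ⟨⟨i + j + 1, i⟩, ?_, ?_⟩
    · simp only [Finset.mem_sigma, Finset.mem_filter, Nat.mem_divisors, Finset.mem_range]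
      refine ⟨⟨⟨⟨x, hMx⟩, hM.ne'⟩, ?_⟩, by omega⟩
      rw [hdiv]; exact hx
    · simp only [hdiv, Prod.mk.injEq, true_and, and_true]
      omega
  · rintro ⟨d, i⟩ h
    simp only [Finset.mem_sigma, Finset.mem_filter, Nat.mem_divisors, Finset.mem_range] at h
    simp only [FF]
    have : ((2 * i + 1 : ℕ) : ℤ) + ((2 * d - 2 * i - 1 : ℕ) : ℤ) = 2 * d := by omega
    rw [this]
    split_ifs <;> first | rfl | omega

lemma final_sum (M α β m₁ : ℕ) (hm₁ : 0 < m₁) (hcop : Nat.Coprime m₁ 6)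
    (h : M = 2 ^ α * 3 ^ β * m₁) :
    ∑ d ∈ M.divisors.filter (fun d => (M / d) % 2 = 1 ∧ ¬ d % 3 = 0), (d : ℤ)
      = 2 ^ α * ∑ d ∈ m₁.divisors, (d : ℤ) := by
  have hc2 : Nat.Coprime m₁ 2 := Nat.Coprime.coprime_dvd_right (by norm_num) hcop
  have hc3 : Nat.Coprime m₁ 3 := Nat.Coprime.coprime_dvd_right (by norm_num) hcop
  have hM : 0 < M := by rw [h]; positivity
  have : M.divisors.filter (fun d => (M / d) % 2 = 1 ∧ ¬ d % 3 = 0) = m₁.divisors.image (fun e => 2 ^ α * e) := by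
    ext d
    simp only [Finset.mem_filter, Finset.mem_image, Nat.mem_divisors]
    constructor
    · rintro ⟨⟨⟨x, hx⟩, -⟩, ho, h3⟩
      have hd0 : 0 < d := by
        rcases Nat.eq_zero_or_pos d with h0 | h0
        · subst h0; omega
        · exact h0
      have hdx : M / d = x := by rw [hx]; exact Nat.mul_div_cancel_left _ hd0
      rw [hdx] at ho
      have hx2 : Nat.Coprime (2 ^ α) x := by
        apply Nat.Coprime.pow_left
        rw [Nat.coprime_two_left, Nat.odd_iff]; exact ho
      have h2d : 2 ^ α ∣ d := by
        apply hx2.dvd_of_dvd_mul_right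
        rw [← hx, h, mul_assoc]; exact dvd_mul_right _ _
      obtain ⟨e, rfl⟩ := h2d
      refine ⟨e, ⟨?_, hm₁.ne'⟩, rfl⟩
      have he : 3 ^ β * m₁ = e * x := by
        have : 0 < 2 ^ α := by positivity
        apply Nat.eq_of_mul_eq_mul_left this
        rw [← mul_assoc, ← h, hx, mul_assoc]
      have he3 : Nat.Coprime e (3 ^ β) := by
        apply Nat.Coprime.pow_right
        rw [Nat.coprime_comm, Nat.Prime.coprime_iff_not_dvd (by norm_num)]
        intro h'
        exact h3 (Nat.mod_eq_zero_of_dvd (h'.mul_left _))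
      exact he3.dvd_of_dvd_mul_left ⟨x, he⟩
    · rintro ⟨e, ⟨⟨f, hf⟩, -⟩, rfl⟩
      have hMe : M = (2 ^ α * e) * (3 ^ β * f) := by rw [h, hf]; ring
      have he0 : 0 < e := by
        rcases Nat.eq_zero_or_pos e with h0 | h0
        · subst h0; omega
        · exact h0
      refine ⟨⟨⟨_, hMe⟩, hM.ne'⟩, ?_, ?_⟩
      · have : M / (2 ^ α * e) = 3 ^ β * f := by
          rw [hMe]; exact Nat.mul_div_cancel_left _ (by positivity)
        rw [this, ← Nat.odd_iff, Nat.odd_mul]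
        refine ⟨Odd.pow (by decide), ?_⟩
        rw [Nat.coprime_two_right, hf, Nat.odd_mul] at hc2
        exact hc2.2
      · intro h0
        have hd := Nat.dvd_of_mod_eq_zero h0
        rcases (Nat.Prime.dvd_mul (by norm_num)).1 hd with h' | h'
        · have := Nat.Prime.dvd_of_dvd_pow (by norm_num) h'
          omega
        · have : 3 ∣ m₁ := by rw [hf]; exact h'.mul_right f
          have := Nat.Coprime.eq_one_of_dvd hc3.symm this
          omega
  rw [this, Finset.sum_image, Finset.mul_sum]
  · push_cast; rfl
  · intro a _ b _ hab
    exact Nat.eq_of_mul_eq_mul_left (by positivity) hab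

theorem stmt18 (m α β m₁ : ℕ) (hm : 0 < m) (hm₁ : 0 < m₁)
    (hcop : Nat.Coprime m₁ 6) (h : m + 1 = 2 ^ α * 3 ^ β * m₁) :
    t 1 1 6 24 (4 * m + 1) = 2 * t 2 2 3 3 m ∧
    t 1 1 6 24 (4 * m) = t 1 1 3 3 m ∧
    t 1 1 3 3 m = 2 ^ (α + 4) * (∑ d ∈ m₁.divisors, d) := by
  have e1 : t 1 1 6 24 (4 * m + 1) = 4 * (TT (4 * m + 5)).ncard := by
    rw [t_eq, ← OO_A]
    push_cast
    congr 2
  have e2 : t 1 1 6 24 (4 * m) = 4 * (TT (4 * (m + 1))).ncard := by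
    rw [t_eq, ← OO_A]
    push_cast
    congr 2
  have e3 : t 2 2 3 3 m = 2 * (TT (4 * m + 5)).ncard := by
    rw [t_eq, ← OO_C]
    push_cast
    congr 2
  have e4 : t 1 1 3 3 m = (OO 1 1 3 3 (8 * ((m + 1 : ℕ) : ℤ))).ncard := by
    rw [t_eq]
    push_cast
    congr 2
  refine ⟨by omega, ?_, ?_⟩
  · rw [e2, e4, OO_B]
    push_cast
    rfl
  · rw [e4, OO_sum]
    have := sum_LL (m + 1)
    rw [liouville, diag_sum (m + 1) (by omega), final_sum (m + 1) α β m₁ hm₁ hcop h] at this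
    zify
    push_cast at this
    rw [this]
    ring
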